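/- Let G = F_2^n and suppose X_1, X_2 are finitely supported G-valued random variables with d[X_1; X_2] = 0. Then there exists a subgroup H ≤ G such that d[X_1; U_H] = d[X_2; U_H] = 0, where U_H denotes a uniformly distributed random variable on H. -/

import Mathlib

open scoped Classical BigOperators Pointwise
open Finset

noncomputable section

/-- The probability that the random variable `X` equals `s`, under the pmf `μ`. -/
def pmass {Ω S : Type*} [Fintype Ω] (μ : Ω → ℝ) (X : Ω → S) (s : S) : ℝ :=
  ∑ ω, if X ω = s then μ ω else 0

/-- `μ` is a probability mass function on the finite type `Ω`. -/
def IsProb {Ω : Type*} [Fintype Ω] (μ : Ω → ℝ) : Prop :=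
  (∀ ω, 0 ≤ μ ω) ∧ ∑ ω, μ ω = 1

/-- Shannon entropy `H[X]` of a random variable `X : Ω → S` under `μ`. -/
def ent {Ω S : Type*} [Fintype Ω] (μ : Ω → ℝ) (X : Ω → S) : ℝ :=
  ∑ s ∈ Finset.univ.image X, Real.negMulLog (pmass μ X s)

/-- Mutual information `I[X : Y]`. -/
def mutualInfo {Ω S T : Type*} [Fintype Ω] (μ : Ω → ℝ) (X : Ω → S) (Y : Ω → T) : ℝ :=
  ent μ X + ent μ Y - ent μ (fun ω => (X ω, Y ω))

/-- The conditional measure, conditioning on the event `Y = y`. -/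
def condMeas {Ω T : Type*} [Fintype Ω] (μ : Ω → ℝ) (Y : Ω → T) (y : T) : Ω → ℝ :=
  fun ω => if Y ω = y then μ ω / pmass μ Y y else 0

/-- Conditional mutual information `I[X : Y | Z]`. -/
def condMutualInfo {Ω S T U : Type*} [Fintype Ω] (μ : Ω → ℝ)
    (X : Ω → S) (Y : Ω → T) (Z : Ω → U) : ℝ :=
  ∑ z ∈ Finset.univ.image Z, pmass μ Z z * mutualInfo (condMeas μ Z z) X Y

/-- Entropic Ruzsa distance `d[X ; Y]`, defined via independent copies on a product space. -/
def rdist {Ω₁ Ω₂ G : Type*} [Fintype Ω₁] [Fintype Ω₂] [AddCommGroup G]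
    (μ₁ : Ω₁ → ℝ) (X : Ω₁ → G) (μ₂ : Ω₂ → ℝ) (Y : Ω₂ → G) : ℝ :=
  ent (fun p : Ω₁ × Ω₂ => μ₁ p.1 * μ₂ p.2) (fun p => X p.1 - Y p.2)
    - ent μ₁ X / 2 - ent μ₂ Y / 2

/-- Conditional Ruzsa distance `d[X | Z ; Y | W]`. -/
def condRdist {Ω₁ Ω₂ G T U : Type*} [Fintype Ω₁] [Fintype Ω₂] [AddCommGroup G]
    (μ₁ : Ω₁ → ℝ) (X : Ω₁ → G) (Z : Ω₁ → T)
    (μ₂ : Ω₂ → ℝ) (Y : Ω₂ → G) (W : Ω₂ → U) : ℝ :=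
  ∑ z ∈ Finset.univ.image Z, ∑ w ∈ Finset.univ.image W,
    pmass μ₁ Z z * pmass μ₂ W w * rdist (condMeas μ₁ Z z) X (condMeas μ₂ W w) Y

/-- Conditional Ruzsa distance `d[X ; Y | W]`, conditioning only on the right variable. -/
def condRdistRight {Ω₁ Ω₂ G U : Type*} [Fintype Ω₁] [Fintype Ω₂] [AddCommGroup G]
    (μ₁ : Ω₁ → ℝ) (X : Ω₁ → G)
    (μ₂ : Ω₂ → ℝ) (Y : Ω₂ → G) (W : Ω₂ → U) : ℝ :=
  ∑ w ∈ Finset.univ.image W, pmass μ₂ W w * rdist μ₁ X (condMeas μ₂ W w) Y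

/-- The uniform probability mass function on a subset `H` of a finite type. -/
def unifOn {G : Type*} [Fintype G] (H : Set G) : G → ℝ :=
  fun g => if g ∈ H then ((Nat.card H : ℝ))⁻¹ else 0

/-- `X` (under `μ₁`) and `Y` (under `μ₂`) are identically distributed. -/
def IdentDist {Ω₁ Ω₂ S : Type*} [Fintype Ω₁] [Fintype Ω₂]
    (μ₁ : Ω₁ → ℝ) (X : Ω₁ → S) (μ₂ : Ω₂ → ℝ) (Y : Ω₂ → S) : Prop :=
  ∀ s, pmass μ₁ X s = pmass μ₂ Y s

/-- Two random variables are independent. -/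
def IndepPair {Ω S T : Type*} [Fintype Ω] (μ : Ω → ℝ) (X : Ω → S) (Y : Ω → T) : Prop :=
  ∀ s t, pmass μ (fun ω => (X ω, Y ω)) (s, t) = pmass μ X s * pmass μ Y t

/-- Three random variables are jointly independent. -/
def IndepTriple {Ω S T U : Type*} [Fintype Ω] (μ : Ω → ℝ)
    (X : Ω → S) (Y : Ω → T) (Z : Ω → U) : Prop :=
  ∀ s t u, pmass μ (fun ω => (X ω, Y ω, Z ω)) (s, t, u)
    = pmass μ X s * pmass μ Y t * pmass μ Z u

/-- Four random variables are jointly independent. -/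
def IndepFour {Ω S T U V : Type*} [Fintype Ω] (μ : Ω → ℝ)
    (X : Ω → S) (Y : Ω → T) (Z : Ω → U) (W : Ω → V) : Prop :=
  ∀ s t u v, pmass μ (fun ω => (X ω, Y ω, Z ω, W ω)) (s, t, u, v)
    = pmass μ X s * pmass μ Y t * pmass μ Z u * pmass μ W v


section Helpers

variable {n : ℕ}

lemma gg_add_self (x : Fin n → ZMod 2) : x + x = 0 := by
  ext i
  simpa using CharTwo.add_self_eq_zero (x i)

lemma gg_sub (x y : Fin n → ZMod 2) : x - y = x + y := by
  rw [sub_eq_iff_eq_add, add_assoc, gg_add_self, add_zero]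

lemma ent_eq_sum {Ω S : Type*} [Fintype Ω] [Fintype S] (μ : Ω → ℝ) (X : Ω → S) :
    ent μ X = ∑ s, Real.negMulLog (pmass μ X s) := by
  unfold ent
  apply Finset.sum_subset (Finset.subset_univ _)
  intro s _ hs
  have : pmass μ X s = 0 := by
    unfold pmass
    apply Finset.sum_eq_zero
    intro ω _
    rw [if_neg]
    rintro rfl
    exact hs (Finset.mem_image_of_mem _ (Finset.mem_univ _))
  simp [this]

lemma pmass_nonneg {Ω S : Type*} [Fintype Ω] {μ : Ω → ℝ} (h : IsProb μ) (X : Ω → S) (s : S) :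
    0 ≤ pmass μ X s := by
  unfold pmass
  apply Finset.sum_nonneg
  intro ω _
  split_ifs
  · exact h.1 ω
  · exact le_rfl

lemma pmass_sum {Ω S : Type*} [Fintype Ω] [Fintype S] {μ : Ω → ℝ} (h : IsProb μ) (X : Ω → S) :
    ∑ s, pmass μ X s = 1 := by
  unfold pmass
  rw [Finset.sum_comm]
  simpa using h.2

lemma sum_pmass_mul {Ω S : Type*} [Fintype Ω] [Fintype S] (μ : Ω → ℝ) (X : Ω → S) (f : S → ℝ) :
    ∑ s, pmass μ X s * f s = ∑ ω, μ ω * f (X ω) := by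
  unfold pmass
  simp_rw [Finset.sum_mul]
  rw [Finset.sum_comm]
  simp [ite_mul]

lemma pmass_conv {Ω₁ Ω₂ : Type*} [Fintype Ω₁] [Fintype Ω₂] (μ₁ : Ω₁ → ℝ) (μ₂ : Ω₂ → ℝ)
    (X : Ω₁ → (Fin n → ZMod 2)) (Y : Ω₂ → (Fin n → ZMod 2)) (z : Fin n → ZMod 2) :
    pmass (fun p : Ω₁ × Ω₂ => μ₁ p.1 * μ₂ p.2) (fun p => X p.1 - Y p.2) z
      = ∑ y, pmass μ₂ Y y * pmass μ₁ X (z + y) := by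
  rw [sum_pmass_mul]
  unfold pmass
  rw [Fintype.sum_prod_type, Finset.sum_comm]
  refine Finset.sum_congr rfl fun b _ => ?_
  rw [Finset.mul_sum]
  refine Finset.sum_congr rfl fun a _ => ?_
  simp only [sub_eq_iff_eq_add, mul_ite, mul_zero, mul_comm]

lemma conv_comm (p q : (Fin n → ZMod 2) → ℝ) (z : Fin n → ZMod 2) :
    ∑ y, q y * p (z + y) = ∑ y, p y * q (z + y) := by
  rw [← Equiv.sum_comp (Equiv.addLeft z)]
  refine Finset.sum_congr rfl fun y _ => ?_
  simp only [Equiv.coe_addLeft, ← add_assoc, gg_add_self, zero_add, mul_comm]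

lemma sum_shift (f : (Fin n → ZMod 2) → ℝ) (y : Fin n → ZMod 2) :
    ∑ z, f (z + y) = ∑ z, f z :=
  Equiv.sum_comp (Equiv.addRight y) f

lemma jensen_pt (p q : (Fin n → ZMod 2) → ℝ) (hp : ∀ x, 0 ≤ p x) (hq : ∀ x, 0 ≤ q x)
    (hq1 : ∑ x, q x = 1) (z : Fin n → ZMod 2) :
    ∑ y, q y * Real.negMulLog (p (z + y)) ≤ Real.negMulLog (∑ y, q y * p (z + y)) := by
  have := Real.concaveOn_negMulLog.le_map_sum (t := Finset.univ) (w := q)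
    (p := fun y => p (z + y)) (fun i _ => hq i) hq1 (fun i _ => hp _)
  simpa using this

lemma sum_sum_shift (p q : (Fin n → ZMod 2) → ℝ) (hq1 : ∑ x, q x = 1) :
    ∑ z, ∑ y, q y * Real.negMulLog (p (z + y)) = ∑ x, Real.negMulLog (p x) := by
  rw [Finset.sum_comm]
  simp_rw [← Finset.mul_sum]
  simp_rw [sum_shift (fun x => Real.negMulLog (p x))]
  rw [← Finset.sum_mul, hq1, one_mul]

lemma ent_le (p q : (Fin n → ZMod 2) → ℝ) (hp : ∀ x, 0 ≤ p x) (hq : ∀ x, 0 ≤ q x)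
    (hq1 : ∑ x, q x = 1) :
    ∑ x, Real.negMulLog (p x) ≤ ∑ z, Real.negMulLog (∑ y, q y * p (z + y)) := by
  rw [← sum_sum_shift p q hq1]
  exact Finset.sum_le_sum fun z _ => jensen_pt p q hp hq hq1 z

lemma ent_eq_imp (p q : (Fin n → ZMod 2) → ℝ) (hp : ∀ x, 0 ≤ p x) (hq : ∀ x, 0 ≤ q x)
    (hq1 : ∑ x, q x = 1)
    (h : ∑ z, Real.negMulLog (∑ y, q y * p (z + y)) = ∑ x, Real.negMulLog (p x))
    (a b : Fin n → ZMod 2) (ha : q a ≠ 0) (hb : q b ≠ 0) (x : Fin n → ZMod 2) :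
    p (x + (a + b)) = p x := by
  rw [← sum_sum_shift p q hq1] at h
  have h2 := (Finset.sum_eq_sum_iff_of_le
    (fun z _ => jensen_pt p q hp hq hq1 z)).1 h.symm
  have key : ∀ z, p (z + a) = p (z + b) := by
    intro z
    have h3 := h2 z (Finset.mem_univ _)
    have := (Real.strictConcaveOn_negMulLog.map_sum_eq_iff' (t := Finset.univ) (w := q)
      (p := fun y => p (z + y)) (fun i _ => hq i) hq1 (fun i _ => hp _)).1
        (by simpa using h3.symm)
    rw [this a (Finset.mem_univ a) ha, this b (Finset.mem_univ b) hb]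
  have := key (x + b)
  rw [add_assoc x b b, gg_add_self, add_zero] at this
  rw [← this, add_assoc, add_comm a b]

/-- Stabilizer of a function. -/
def stab (p : (Fin n → ZMod 2) → ℝ) : AddSubgroup (Fin n → ZMod 2) where
  carrier := {h | ∀ x, p (x + h) = p x}
  zero_mem' := by intro x; simp
  add_mem' := by
    intro a b ha hb x
    rw [← add_assoc, hb, ha]
  neg_mem' := by
    intro a ha x
    have := ha (x + -a)
    rw [← this]; simp

lemma unif_pmass (H : AddSubgroup (Fin n → ZMod 2)) (x : Fin n → ZMod 2) :
    pmass (unifOn (H : Set (Fin n → ZMod 2))) (fun g => g) x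
      = unifOn (H : Set (Fin n → ZMod 2)) x := by
  unfold pmass
  rw [Finset.sum_eq_single x]
  · exact if_pos rfl
  · intro b _ hb
    exact if_neg hb
  · intro h
    exact absurd (Finset.mem_univ x) h

lemma unif_sum (H : AddSubgroup (Fin n → ZMod 2)) :
    ∑ x, unifOn (H : Set (Fin n → ZMod 2)) x = 1 := by
  unfold unifOn
  rw [← Finset.sum_filter, Finset.sum_const, nsmul_eq_mul]
  have : (#{x | x ∈ (H : Set (Fin n → ZMod 2))} ) = Nat.card (H : Set (Fin n → ZMod 2)) := by
    rw [Nat.card_eq_fintype_card, Fintype.card_subtype]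
  rw [this]
  apply mul_inv_cancel₀
  have : 0 < Nat.card (H : Set (Fin n → ZMod 2)) := Nat.card_pos
  positivity

lemma eq_unif (H : AddSubgroup (Fin n → ZMod 2)) (p : (Fin n → ZMod 2) → ℝ)
    (hp1 : ∑ x, p x = 1) (x0 : Fin n → ZMod 2)
    (hinv : ∀ h ∈ H, ∀ x, p (x + h) = p x) (hsupp : ∀ x, p x ≠ 0 → x + x0 ∈ H)
    (x : Fin n → ZMod 2) :
    p (x + x0) = unifOn (H : Set (Fin n → ZMod 2)) x := by
  set N : ℝ := (Nat.card (H : Set (Fin n → ZMod 2)) : ℝ) with hN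
  have hNpos : 0 < N := by
    have : 0 < Nat.card (H : Set (Fin n → ZMod 2)) := Nat.card_pos
    rw [hN]; positivity
  have h1 : ∀ x, p (x + x0) = (p x0 * N) * unifOn (H : Set (Fin n → ZMod 2)) x := by
    intro x
    unfold unifOn
    by_cases hx : x ∈ H
    · simp only [SetLike.mem_coe, hx, if_true]
      rw [← hN, mul_inv_cancel_right₀ hNpos.ne', add_comm, hinv x hx]
    · simp only [SetLike.mem_coe, hx, if_false, mul_zero]
      by_contra hne
      have := hsupp _ hne
      rw [add_assoc, gg_add_self, add_zero] at this
      exact hx this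
  have h2 : p x0 * N = 1 := by
    rw [← hp1, ← sum_shift p x0]
    simp_rw [h1]
    rw [← Finset.mul_sum, unif_sum, mul_one]
  rw [h1, h2, one_mul]

lemma rdist_unif_zero {Ω : Type*} [Fintype Ω] (μ : Ω → ℝ) (hμ : IsProb μ)
    (X : Ω → (Fin n → ZMod 2)) (H : AddSubgroup (Fin n → ZMod 2)) (x0 : Fin n → ZMod 2)
    (hinv : ∀ h ∈ H, ∀ x, pmass μ X (x + h) = pmass μ X x)
    (hsupp : ∀ x, pmass μ X x ≠ 0 → x + x0 ∈ H) :
    rdist μ X (unifOn (H : Set (Fin n → ZMod 2))) (fun g => g) = 0 := by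
  have hu := eq_unif H (pmass μ X) (pmass_sum hμ X) x0 hinv hsupp
  unfold rdist
  have hcv := pmass_conv μ (unifOn (H : Set (Fin n → ZMod 2))) X (fun g => g)
  simp only [ent_eq_sum]
  simp_rw [hcv, unif_pmass]
  have h1 : ∀ z, ∑ y, unifOn (H : Set (Fin n → ZMod 2)) y * pmass μ X (z + y)
      = pmass μ X z := by
    intro z
    have : ∀ y, unifOn (H : Set (Fin n → ZMod 2)) y * pmass μ X (z + y)
        = unifOn (H : Set (Fin n → ZMod 2)) y * pmass μ X z := by
      intro y
      by_cases hy : y ∈ H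
      · rw [hinv y hy]
      · simp [unifOn, hy]
    simp_rw [this]
    rw [← Finset.sum_mul, unif_sum, one_mul]
  simp_rw [h1, ← hu]
  rw [sum_shift (fun x => Real.negMulLog (pmass μ X x))]
  ring

lemma exists_mass_ne {p : (Fin n → ZMod 2) → ℝ} (h : ∑ x, p x = 1) : ∃ x, p x ≠ 0 := by
  by_contra hc
  push Not at hc
  simp [hc] at h

end Helpers

/-- **The 100% case.** If `X₁, X₂` are finitely supported `F_2^n`-valued random
variables with `d[X₁; X₂] = 0`, then there is a subgroup `H` with
`d[X₁; U_H] = d[X₂; U_H] = 0`. -/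
theorem exact_case {n : ℕ} {Ω₁ Ω₂ : Type} [Fintype Ω₁] [Fintype Ω₂]
    (μ₁ : Ω₁ → ℝ) (μ₂ : Ω₂ → ℝ) (hμ₁ : IsProb μ₁) (hμ₂ : IsProb μ₂)
    (X₁ : Ω₁ → (Fin n → ZMod 2)) (X₂ : Ω₂ → (Fin n → ZMod 2))
    (hdist : rdist μ₁ X₁ μ₂ X₂ = 0) :
    ∃ H : AddSubgroup (Fin n → ZMod 2),
      rdist μ₁ X₁ (unifOn (H : Set (Fin n → ZMod 2))) (fun g => g) = 0 ∧
      rdist μ₂ X₂ (unifOn (H : Set (Fin n → ZMod 2))) (fun g => g) = 0 := by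
  have hp := pmass_nonneg hμ₁ X₁
  have hq := pmass_nonneg hμ₂ X₂
  have hp1 := pmass_sum hμ₁ X₁
  have hq1 := pmass_sum hμ₂ X₂
  unfold rdist at hdist
  simp_rw [ent_eq_sum, pmass_conv] at hdist
  have e1 := ent_le _ _ hp hq hq1
  have e2 := ent_le _ _ hq hp hp1
  have hc : ∑ z, Real.negMulLog (∑ y, pmass μ₁ X₁ y * pmass μ₂ X₂ (z + y))
      = ∑ z, Real.negMulLog (∑ y, pmass μ₂ X₂ y * pmass μ₁ X₁ (z + y)) :=
    Finset.sum_congr rfl fun z _ => by rw [conv_comm]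
  have i1 := ent_eq_imp _ _ hp hq hq1 (by linarith)
  have i2 := ent_eq_imp _ _ hq hp hp1 (by linarith)
  obtain ⟨x0, hx0⟩ := exists_mass_ne hp1
  obtain ⟨y0, hy0⟩ := exists_mass_ne hq1
  have cancel : ∀ a b : Fin n → ZMod 2, a + b + a = b := fun a b => by
    rw [add_comm a b, add_assoc, gg_add_self, add_zero]
  have hKH : ∀ k ∈ stab (pmass μ₂ X₂), k ∈ stab (pmass μ₁ X₁) := by
    intro k hk x
    have := i1 (y0 + k) y0 (by rw [hk y0]; exact hy0) hy0 x
    rwa [cancel] at this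
  have hHK : ∀ k ∈ stab (pmass μ₁ X₁), k ∈ stab (pmass μ₂ X₂) := by
    intro k hk x
    have := i2 (x0 + k) x0 (by rw [hk x0]; exact hx0) hx0 x
    rwa [cancel] at this
  refine ⟨stab (pmass μ₁ X₁), ?_, ?_⟩
  · exact rdist_unif_zero μ₁ hμ₁ X₁ _ x0 (fun h hh => hh)
      (fun x hx => hKH _ (i2 x x0 hx hx0))
  · exact rdist_unif_zero μ₂ hμ₂ X₂ _ y0 (fun h hh => hHK h hh)
      (fun x hx => i1 x y0 hx hy0)

end
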